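/- Let m ≥ 3 be an odd integer, ω = e^{2πi/m}, and let A be a unital associative ℂ-algebra. Suppose u, v ∈ A satisfy v^m = 1 and u·v = ω^{-2}·(v·u). Then u·g(v) = ω^{-1}·v·g(v)·u, where g(v) = (1/√m)·Σ_{j=0}^{m-1} ω^{j²}·v^j. Consequently, since g(v) is invertible, g(v)^{-1}·u·g(v) = ω^{-1}·(v·u). -/

import Mathlib

open Finset

/-- The Gaussian element `g(v) = (1/√m)·Σ_{j=0}^{m-1} ω^{j²}·v^j` in a unital
associative `ℂ`-algebra. -/
noncomputable def gauss {A : Type*} [Ring A] [Algebra ℂ A] (m : ℕ) (ω : ℂ)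
    (v : A) : A :=
  ((1 / Real.sqrt m : ℝ) : ℂ) • ∑ j ∈ Finset.range m, ω ^ (j ^ 2) • v ^ j

theorem mul_pow_of_mul_eq_smul {K A : Type*} [CommSemiring K] [Semiring A] [Algebra K A]
    {q : K} {u v : A} (h : u * v = q • (v * u)) (j : ℕ) :
    u * v ^ j = q ^ j • (v ^ j * u) := by
  induction j with
  | zero => simp
  | succ j ih =>
    rw [pow_succ, ← mul_assoc, ih, smul_mul_assoc, mul_assoc, h, mul_smul_comm, smul_smul,
      ← pow_succ, mul_assoc]

/-- Shifting the summation index by one in a sum over a full period. -/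
theorem sum_range_shift_of_eq {M : Type*} [AddCommMonoid M] (F : ℕ → M) {m : ℕ}
    (h : F m = F 0) : ∑ j ∈ Finset.range m, F (j + 1) = ∑ j ∈ Finset.range m, F j := by
  cases m with
  | zero => simp
  | succ n => rw [Finset.sum_range_succ, h, ← Finset.sum_range_succ']

theorem commute_gauss {A : Type*} [Ring A] [Algebra ℂ A] (m : ℕ) (ω : ℂ) (v : A) :
    Commute v (gauss m ω v) :=
  (Commute.sum_right _ _ _ fun j _ =>
    ((Commute.refl v).pow_right j).smul_right _).smul_right _

theorem mul_gauss_of_pow_eq_one {A : Type*} [Ring A] [Algebra ℂ A] {m : ℕ} {ω : ℂ}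
    (hω0 : ω ≠ 0) (hωm : ω ^ m = 1) {u v : A} (hv : v ^ m = 1)
    (huv : u * v = (ω ^ (-2 : ℤ)) • (v * u)) :
    u * gauss m ω v = ω⁻¹ • (v * (gauss m ω v * u)) := by
  have hperiod : ω ^ ((m : ℤ) ^ 2 - 2 * m) = 1 := by
    rw [show (m : ℤ) ^ 2 - 2 * m = m * (m - 2) by ring, zpow_mul, zpow_natCast, hωm, one_zpow]
  have hshift := sum_range_shift_of_eq
    (fun j : ℕ => ω ^ ((j : ℤ) ^ 2 - 2 * j) • (v ^ j * u)) (m := m) (by simp [hperiod, hv])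
  simp only [gauss, mul_smul_comm, smul_mul_assoc, Finset.mul_sum, Finset.sum_mul,
    mul_pow_of_mul_eq_smul huv]
  rw [smul_comm ω⁻¹, Finset.smul_sum (r := ω⁻¹)]
  congr 1
  calc
    _ = ∑ j ∈ Finset.range m, ω ^ ((j : ℤ) ^ 2 - 2 * j) • (v ^ j * u) := by
      refine Finset.sum_congr rfl fun j _ => ?_
      rw [smul_smul, ← zpow_natCast, ← zpow_natCast, ← zpow_mul, ← zpow_add₀ hω0]
      congr 2
    _ = _ := by
      rw [← hshift]
      refine Finset.sum_congr rfl fun j _ => ?_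
      rw [smul_smul, ← mul_assoc, ← pow_succ', ← zpow_natCast ω, ← zpow_neg_one,
        ← zpow_add₀ hω0]
      congr 2
      push_cast
      ring

/-- If `v^m = 1` and `u·v = ω^{-2}·(v·u)` with `ω = e^{2πi/m}`, `m ≥ 3` odd,
then `u·g(v) = ω^{-1}·v·g(v)·u`; consequently, for any left inverse `w` of
`g(v)`, `w·u·g(v) = ω^{-1}·(v·u)`, i.e. `g(v)^{-1}·u·g(v) = ω^{-1}·(v·u)`. -/
theorem gauss_conjugation (m : ℕ) (hm : 3 ≤ m) (hodd : Odd m)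
    {A : Type*} [Ring A] [Algebra ℂ A]
    (ω : ℂ) (hω : ω = Complex.exp (2 * (Real.pi : ℂ) * Complex.I / (m : ℂ)))
    (u v : A) (hv : v ^ m = 1)
    (huv : u * v = (ω ^ (-2 : ℤ)) • (v * u)) :
    u * gauss m ω v = ω⁻¹ • (v * (gauss m ω v * u)) ∧
    ∀ w : A, w * gauss m ω v = 1 →
      w * (u * gauss m ω v) = ω⁻¹ • (v * u) := by
  have hm0 : m ≠ 0 := by omega
  have hroot : IsPrimitiveRoot ω m := hω ▸ Complex.isPrimitiveRoot_exp m hm0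
  have hmul := mul_gauss_of_pow_eq_one (hroot.ne_zero hm0) hroot.pow_eq_one hv huv
  refine ⟨hmul, fun w hw => ?_⟩
  rw [hmul, mul_smul_comm, ← mul_assoc v, (commute_gauss m ω v).eq, mul_assoc, ← mul_assoc w,
    hw, one_mul]
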